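/- For any labeled poset P, the enriched generating function satisfies Λ(P) = Σ_{π ∈ L(P)} Λ(π), as an identity of formal power series in x₁, x₂, …. -/

import Mathlib

/-- A labeled poset: a finite set of (distinct) positive integers
together with a strict partial order on them. -/
structure LabeledPoset where
  carrier : Finset ℕ+
  lt : ℕ+ → ℕ+ → Prop
  mem_of_lt : ∀ {a b}, lt a b → a ∈ carrier ∧ b ∈ carrier
  lt_irrefl : ∀ a, ¬ lt a a
  lt_trans : ∀ {a b c}, lt a b → lt b c → lt a c

/-- The strict total order determined by a list: `a` occurs (strictly) before `b`. -/
def chainRel {α : Type*} (l : List α) (a b : α) : Prop :=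
  ∃ i j : Fin l.length, i < j ∧ l.get i = a ∧ l.get j = b

/-- `π` is a linear extension of the poset whose elements are given by `mem`
and whose order is `r`. -/
def IsLinearExtension {α : Type*} (mem : α → Prop) (r : α → α → Prop) (π : List α) : Prop :=
  π.Nodup ∧ (∀ x, x ∈ π ↔ mem x) ∧ ∀ a b, r a b → chainRel π a b

/-- `f` is an enriched `P`-partition for the strict order `r` on the carrier `c`,
with values in `ℙ^± = Lex (ℕ+ × Bool)`, i.e. `−1 < 1 < −2 < 2 < ⋯`
(`false` is the sign `−`, `true` is `+`). -/
def IsEnrichedPPartition {S : Type*} [LinearOrder S] {c : Finset ℕ+} (r : ℕ+ → ℕ+ → Prop)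
    (f : {x // x ∈ c} → Lex (S × Bool)) : Prop :=
  ∀ a b : {x // x ∈ c}, r a.1 b.1 →
    ((a : ℕ+) < (b : ℕ+) → f a < f b ∨ (f a = f b ∧ (ofLex (f a)).2 = true)) ∧
    ((b : ℕ+) < (a : ℕ+) → f a < f b ∨ (f a = f b ∧ (ofLex (f a)).2 = false))

/-- The generating function `Σ_f Π_i x_{v(f i)}` over all maps `f : ι → A`
satisfying `cond`. -/
noncomputable def genGF {ι A σ : Type*} (cond : (ι → A) → Prop) (v : A → σ) :
    MvPowerSeries σ ℚ :=
  fun d => (Nat.card {f : ι → A // cond f ∧ ∀ s : σ, Nat.card {i : ι // v (f i) = s} = d s} : ℚ)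

/-- The sorting key refining `f` to a strict total order. -/
def epKey {c : Finset ℕ+} (f : {x // x ∈ c} → Lex (ℕ+ × Bool)) (a : {x // x ∈ c}) :
    Lex (Lex (ℕ+ × Bool) × ℤ) :=
  toLex (f a, if (ofLex (f a)).2 = true then ((a : ℕ+) : ℕ) else -(((a : ℕ+) : ℕ) : ℤ))

theorem epKey_inj {c : Finset ℕ+} (f : {x // x ∈ c} → Lex (ℕ+ × Bool)) :
    Function.Injective (epKey f) := by
  intro a b h
  have h' := congrArg ofLex h
  simp only [epKey, ofLex_toLex, Prod.mk.injEq] at h'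
  obtain ⟨h1, h2⟩ := h'
  rw [h1] at h2
  apply Subtype.ext
  apply PNat.coe_injective
  split_ifs at h2 <;> omega

theorem epKey_lt {c : Finset ℕ+} (f : {x // x ∈ c} → Lex (ℕ+ × Bool)) (a b : {x // x ∈ c}) :
    epKey f a < epKey f b ↔ f a < f b ∨ (f a = f b ∧
      (((ofLex (f a)).2 = true ∧ (a : ℕ+) < b) ∨ ((ofLex (f a)).2 = false ∧ (b : ℕ+) < a))) := by
  unfold epKey
  rw [Prod.Lex.toLex_lt_toLex]
  refine or_congr Iff.rfl (and_congr_right fun h => ?_)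
  simp only at h
  simp only [← h, ← PNat.coe_lt_coe]
  cases (ofLex (f a)).2 <;> simp

theorem enriched_iff {c : Finset ℕ+} (r : ℕ+ → ℕ+ → Prop) (hr : ∀ a, ¬ r a a)
    (f : {x // x ∈ c} → Lex (ℕ+ × Bool)) :
    IsEnrichedPPartition r f ↔ ∀ a b : {x // x ∈ c}, r a.1 b.1 → epKey f a < epKey f b := by
  unfold IsEnrichedPPartition
  refine forall_congr' fun a => forall_congr' fun b => imp_congr_right fun h => ?_
  rw [epKey_lt]
  have hne : (a : ℕ+) ≠ b := fun e => hr _ (e ▸ h)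
  rcases lt_or_gt_of_ne hne with h1 | h1
  · simp [h1, h1.not_gt]
  · simp [h1, h1.not_gt]

/-- Strict order on labels induced by the key. -/
def epRel {c : Finset ℕ+} (f : {x // x ∈ c} → Lex (ℕ+ × Bool)) (a b : ℕ+) : Prop :=
  ∃ (ha : a ∈ c) (hb : b ∈ c), epKey f ⟨a, ha⟩ < epKey f ⟨b, hb⟩

theorem pairwise_iff_chainRel {α : Type*} (l : List α) (R : α → α → Prop) :
    l.Pairwise R ↔ ∀ a b, chainRel l a b → R a b := by
  rw [List.pairwise_iff_get]
  constructor
  · rintro h a b ⟨i, j, hij, rfl, rfl⟩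
    exact h i j hij
  · intro h i j hij
    exact h _ _ ⟨i, j, hij, rfl, rfl⟩

theorem chainRel_irrefl {α : Type*} {l : List α} (hl : l.Nodup) (a : α) : ¬ chainRel l a a := by
  rintro ⟨i, j, hij, h1, h2⟩
  exact hij.ne (List.nodup_iff_injective_get.1 hl (h1.trans h2.symm))

theorem chainRel_total {α : Type*} {l : List α} {a b : α} (ha : a ∈ l) (hb : b ∈ l)
    (hab : a ≠ b) : chainRel l a b ∨ chainRel l b a := by
  obtain ⟨i, rfl⟩ := List.get_of_mem ha
  obtain ⟨j, rfl⟩ := List.get_of_mem hb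
  have : i ≠ j := fun h => hab (h ▸ rfl)
  rcases lt_or_gt_of_ne this with h | h
  · exact Or.inl ⟨i, j, h, rfl, rfl⟩
  · exact Or.inr ⟨j, i, h, rfl, rfl⟩

theorem enriched_chain_iff {c : Finset ℕ+} {l : List ℕ+} (hl : l.Nodup) (hm : ∀ x, x ∈ l ↔ x ∈ c)
    (f : {x // x ∈ c} → Lex (ℕ+ × Bool)) :
    IsEnrichedPPartition (chainRel l) f ↔ l.Pairwise (epRel f) := by
  rw [enriched_iff _ (chainRel_irrefl hl), pairwise_iff_chainRel]
  constructor
  · intro h a b hab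
    have hab' := hab
    obtain ⟨i, j, hij, rfl, rfl⟩ := hab'
    exact ⟨(hm _).1 (List.get_mem _ _), (hm _).1 (List.get_mem _ _), h ⟨_, _⟩ ⟨_, _⟩ hab⟩
  · intro h a b hab
    obtain ⟨_, _, h'⟩ := h _ _ hab
    exact h'

theorem exists_sorted_aux {α β : Type*} [Fintype α] [LinearOrder β] (k : α → β)
    (hk : Function.Injective k) :
    ∃ l : List α, l.Nodup ∧ (∀ x, x ∈ l) ∧ l.Pairwise (fun a b => k a < k b) := by
  classical
  let _ : LinearOrder α := LinearOrder.lift' k hk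
  refine ⟨(Finset.univ : Finset α).sort, Finset.sort_nodup _ _, by simp, ?_⟩
  exact (Finset.sortedLT_sort (Finset.univ : Finset α)).pairwise.imp fun h => h

theorem exists_sorted {c : Finset ℕ+} (f : {x // x ∈ c} → Lex (ℕ+ × Bool)) :
    ∃ l : List ℕ+, l.Nodup ∧ (∀ x, x ∈ l ↔ x ∈ c) ∧ l.Pairwise (epRel f) := by
  obtain ⟨l, h1, h2, h3⟩ := exists_sorted_aux (epKey f) (epKey_inj f)
  refine ⟨l.map Subtype.val, h1.map Subtype.val_injective, by simp [h2], ?_⟩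
  rw [List.pairwise_map]
  exact h3.imp fun {a b} h => ⟨a.2, b.2, h⟩

theorem sorted_unique {c : Finset ℕ+} (f : {x // x ∈ c} → Lex (ℕ+ × Bool)) {l l' : List ℕ+}
    (h1 : l.Nodup) (h2 : ∀ x, x ∈ l ↔ x ∈ c) (h3 : l.Pairwise (epRel f))
    (h1' : l'.Nodup) (h2' : ∀ x, x ∈ l' ↔ x ∈ c) (h3' : l'.Pairwise (epRel f)) : l = l' := by
  refine List.Perm.eq_of_pairwise ?_ h3 h3' ?_
  · rintro a b - - ⟨_, _, h⟩ ⟨_, _, h'⟩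
    exact absurd h h'.not_gt
  · exact (List.perm_ext_iff_of_nodup h1 h1').2 fun x => (h2 x).trans (h2' x).symm

theorem enriched_poset_iff (P : LabeledPoset) {l : List ℕ+}
    (f : {x // x ∈ P.carrier} → Lex (ℕ+ × Bool))
    (hl : l.Nodup) (hm : ∀ x, x ∈ l ↔ x ∈ P.carrier) (hs : l.Pairwise (epRel f)) :
    IsEnrichedPPartition P.lt f ↔ IsLinearExtension (· ∈ P.carrier) P.lt l := by
  rw [enriched_iff _ P.lt_irrefl]
  rw [pairwise_iff_chainRel] at hs
  constructor
  · intro h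
    refine ⟨hl, hm, fun a b hab => ?_⟩
    obtain ⟨ha, hb⟩ := P.mem_of_lt hab
    have hne : a ≠ b := fun e => P.lt_irrefl _ (e ▸ hab)
    refine (chainRel_total ((hm _).2 ha) ((hm _).2 hb) hne).resolve_right fun hc => ?_
    obtain ⟨_, _, h'⟩ := hs _ _ hc
    exact absurd (h ⟨a, ha⟩ ⟨b, hb⟩ hab) h'.not_gt
  · rintro ⟨-, -, h⟩ a b hab
    obtain ⟨_, _, h'⟩ := hs _ _ (h _ _ hab)
    exact h'

theorem finite_linext (P : LabeledPoset) :
    {π : List ℕ+ | IsLinearExtension (· ∈ P.carrier) P.lt π}.Finite := by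
  classical
  refine (P.carrier.toList.permutations.toFinset.finite_toSet).subset ?_
  rintro l ⟨h1, h2, -⟩
  simp only [List.coe_toFinset, Set.mem_ofPred_eq, List.mem_permutations]
  exact (List.perm_ext_iff_of_nodup h1 (Finset.nodup_toList _)).2 (by simpa using h2)

theorem finite_weight (c : Finset ℕ+) (d : ℕ+ →₀ ℕ) :
    {f : {x // x ∈ c} → Lex (ℕ+ × Bool) |
      ∀ s : ℕ+, Nat.card {i // (ofLex (f i)).1 = s} = d s}.Finite := by
  have hfin : {z : Lex (ℕ+ × Bool) | (ofLex z).1 ∈ d.support}.Finite := by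
    have := Finset.finite_toSet (d.support ×ˢ (Finset.univ : Finset Bool))
    refine (this.preimage (f := (ofLex : Lex (ℕ+ × Bool) → ℕ+ × Bool))
      ofLex.injective.injOn).subset ?_
    intro z hz
    simpa using hz
  refine (Set.Finite.pi' (fun _ : {x // x ∈ c} => hfin)).subset ?_
  intro f hf i
  simp only [Set.mem_ofPred_eq, Finsupp.mem_support_iff]
  rw [← hf]
  have : Nonempty {j // (ofLex (f j)).1 = (ofLex (f i)).1} := ⟨⟨i, rfl⟩⟩
  exact Nat.card_pos.ne'

/-- `Λ(P) = Σ_{π ∈ L(P)} Λ(π)`: the enriched `P`-partition generating function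
(the variable of `f i` is `x_{|f i|}`) is the sum of the enriched generating
functions of the linear extensions of `P`. -/
theorem statement8 (P : LabeledPoset) :
    genGF (IsEnrichedPPartition (c := P.carrier) (S := ℕ+) P.lt)
        (fun z => (ofLex z).1) =
      ∑ᶠ π ∈ {π : List ℕ+ | IsLinearExtension (· ∈ P.carrier) P.lt π},
        genGF (IsEnrichedPPartition (c := P.carrier) (S := ℕ+) (chainRel π))
          (fun z => (ofLex z).1) := by
  classical
  rw [finsum_mem_eq_finite_toFinset_sum _ (finite_linext P)]
  ext d
  rw [map_sum]
  have hW := finite_weight P.carrier d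
  have key : ∀ cond : ({x // x ∈ P.carrier} → Lex (ℕ+ × Bool)) → Prop,
      MvPowerSeries.coeff d (genGF cond (fun z : Lex (ℕ+ × Bool) => (ofLex z).1)) =
        ((hW.toFinset.filter cond).card : ℚ) := by
    intro cond
    change ((Nat.card _ : ℕ) : ℚ) = _
    congr 1
    refine Nat.subtype_card _ fun f => ?_
    simp [and_comm]
  simp only [key]
  rw [← Nat.cast_sum, Nat.cast_inj]
  choose srt s1 s2 s3 using fun f : {x // x ∈ P.carrier} → Lex (ℕ+ × Bool) => exists_sorted f
  rw [Finset.card_eq_sum_card_fiberwise (f := srt) (t := (finite_linext P).toFinset)]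
  · refine Finset.sum_congr rfl fun l hl => ?_
    rw [Finset.filter_filter]
    congr 1
    refine Finset.filter_congr fun f _ => ?_
    have hl' : IsLinearExtension (· ∈ P.carrier) P.lt l := by simpa using hl
    rw [enriched_chain_iff hl'.1 hl'.2.1]
    constructor
    · rintro ⟨-, rfl⟩
      exact s3 f
    · intro h
      exact ⟨(enriched_poset_iff P f hl'.1 hl'.2.1 h).2 hl',
        sorted_unique f (s1 f) (s2 f) (s3 f) hl'.1 hl'.2.1 h⟩
  · intro f hf
    have hf' := (Finset.mem_filter.1 hf).2
    simpa using (enriched_poset_iff P f (s1 f) (s2 f) (s3 f)).1 hf'
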